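/- (Step 5.) For every (a,b,c) ∈ O₃, the set {d ∈ W : (b,c,d) ∈ O₃ and (a,b,c) ⇝³⁰⁰ (b,c,d)} contains a dense open subset of W. -/

import Mathlib

open Topology

/-- The set of triples of pairwise distinct points of `W`. -/
def O3 (W : Type*) : Set (W × W × W) :=
  {t | t.1 ≠ t.2.1 ∧ t.1 ≠ t.2.2 ∧ t.2.1 ≠ t.2.2}

/-- The set of quadruples `(a,b,c,d)` with `(a,b,c) ∈ O₃` and `d ∈ D(a,b,c)`. -/
def O4 {W : Type*} (D : W → W → W → Set W) : Set (W × W × W × W) :=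
  {q | (q.1, q.2.1, q.2.2.1) ∈ O3 W ∧ q.2.2.2 ∈ D q.1 q.2.1 q.2.2.1}

/-- The initial triple `(q¹, q², q³)` of a quadruple. -/
def tri1 {W : Type*} (q : W × W × W × W) : W × W × W := (q.1, q.2.1, q.2.2.1)

/-- The final triple `(q³, q², q⁴)` of a quadruple. -/
def tri2 {W : Type*} (q : W × W × W × W) : W × W × W := (q.2.2.1, q.2.1, q.2.2.2)

/-- The triple `(q², q⁴, q³)` of a quadruple, one of the two admissible transitions. -/
def stepA {W : Type*} (q : W × W × W × W) : W × W × W := (q.2.1, q.2.2.2, q.2.2.1)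

/-- The triple `(q³, q², q⁴)` of a quadruple, the other admissible transition. -/
def stepB {W : Type*} (q : W × W × W × W) : W × W × W := (q.2.2.1, q.2.1, q.2.2.2)

/-- `Leads Q p t t'` (written `t ⇝ᵖ t'` in the paper): there is a chain `q₁, …, q_j`
of at most `p` quadruples of `Q` with `(q₁¹,q₁²,q₁³) = t`, `(q_j³,q_j²,q_j⁴) = t'`, and
consecutive quadruples related by one of the two admissible transitions. -/
def Leads {W : Type*} (Q : Set (W × W × W × W)) (p : ℕ) (t t' : W × W × W) : Prop :=
  ∃ j : ℕ, 1 ≤ j ∧ j ≤ p ∧ ∃ q : ℕ → W × W × W × W,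
    (∀ n < j, q n ∈ Q) ∧ tri1 (q 0) = t ∧ tri2 (q (j - 1)) = t' ∧
    ∀ n, n + 1 < j →
      tri1 (q (n + 1)) = stepA (q n) ∨ tri1 (q (n + 1)) = stepB (q n)

open Filter

section

variable {W : Type*}

theorem Leads.mono {Q : Set (W × W × W × W)} {p p' : ℕ} {t t' : W × W × W}
    (h : Leads Q p t t') (hp : p ≤ p') : Leads Q p' t t' := by
  obtain ⟨j, h1, h2, h3⟩ := h
  exact ⟨j, h1, h2.trans hp, h3⟩

theorem Leads.of_mem {Q : Set (W × W × W × W)} {q : W × W × W × W} (hq : q ∈ Q) :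
    Leads Q 1 (tri1 q) (tri2 q) :=
  ⟨1, le_rfl, le_rfl, fun _ => q, fun _ _ => hq, rfl, rfl, fun _ h => by omega⟩

theorem Leads.cons {Q : Set (W × W × W × W)} {p : ℕ} {q : W × W × W × W} {s t' : W × W × W}
    (h : Leads Q p s t') (hq : q ∈ Q) (hs : s = stepA q ∨ s = stepB q) :
    Leads Q (p + 1) (tri1 q) t' := by
  obtain ⟨j, h1, h2, r, hr, rfl, hr1, hr2⟩ := h
  refine ⟨j + 1, by omega, by omega, fun n => Nat.casesOn n q r, ?_, rfl, ?_, ?_⟩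
  · rintro (_ | n) hn
    · exact hq
    · exact hr n (by omega)
  · obtain ⟨k, rfl⟩ := Nat.exists_eq_add_of_le' h1
    exact hr1
  · rintro (_ | n) hn
    · exact hs
    · exact hr2 n (by omega)

/-- Every chain starting from `s` extends by `n` quadruples to a chain starting from `t`. -/
def ReducesTo (Q : Set (W × W × W × W)) (n : ℕ) (t s : W × W × W) : Prop :=
  ∀ p t', Leads Q p s t' → Leads Q (p + n) t t'

theorem ReducesTo.trans {Q : Set (W × W × W × W)} {m n : ℕ} {t s u : W × W × W}
    (h : ReducesTo Q n t s) (h' : ReducesTo Q m s u) : ReducesTo Q (n + m) t u :=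
  fun p t' hp => by
    rw [Nat.add_comm n m, ← Nat.add_assoc]
    exact h _ _ (h' p t' hp)

theorem ReducesTo.of_stepA {Q : Set (W × W × W × W)} {a b c d : W} (h : (a, b, c, d) ∈ Q) :
    ReducesTo Q 1 (a, b, c) (b, d, c) :=
  fun _ _ hp => hp.cons h (Or.inl rfl)

theorem ReducesTo.of_stepB {Q : Set (W × W × W × W)} {a b c d : W} (h : (a, b, c, d) ∈ Q) :
    ReducesTo Q 1 (a, b, c) (c, b, d) :=
  fun _ _ hp => hp.cons h (Or.inr rfl)

variable [MetricSpace W]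

/-- `t` reduces in `n` steps to triples arbitrarily close to `s`. -/
def ApproxReducesTo (Q : Set (W × W × W × W)) (n : ℕ) (t s : W × W × W) : Prop :=
  ∃ᶠ u in 𝓝 s, u ∈ O3 W ∧ ReducesTo Q n t u

theorem ReducesTo.approx {Q : Set (W × W × W × W)} {n : ℕ} {t s : W × W × W}
    (h : ReducesTo Q n t s) (hs : s ∈ O3 W) : ApproxReducesTo Q n t s :=
  fun hn => hn.self_of_nhds ⟨hs, h⟩

theorem ApproxReducesTo.trans {Q : Set (W × W × W × W)} {m n : ℕ} {t s s' : W × W × W}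
    (f : W × W × W → W × W × W) (h : ApproxReducesTo Q n t s) (hf : ContinuousAt f s)
    (hs : f s = s')
    (h' : ∀ᶠ u in 𝓝 s, u ∈ O3 W → ApproxReducesTo Q m u (f u)) :
    ApproxReducesTo Q (n + m) t s' := by
  subst hs
  intro hn
  obtain ⟨u, ⟨hu, htu⟩, hu', hnu⟩ :=
    (h.and_eventually (h'.and (hf.eventually hn.eventually_nhds))).exists
  obtain ⟨v, ⟨hv, huv⟩, hnv⟩ := ((hu' hu).and_eventually hnu).exists
  exact hnv ⟨hv, htu.trans huv⟩

variable {D : W → W → W → Set W}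

theorem frequently_mem_O4
    (h3 : ∀ a b c : W, (a, b, c) ∈ O3 W → a ∈ closure (D a b c))
    {a b c : W} (h : (a, b, c) ∈ O3 W) : ∃ᶠ d in 𝓝 a, (a, b, c, d) ∈ O4 D :=
  (mem_closure_iff_frequently.1 (h3 a b c h)).mono fun _ hd => ⟨h, hd⟩

theorem approxReducesTo_swap12
    (h3 : ∀ a b c : W, (a, b, c) ∈ O3 W → a ∈ closure (D a b c))
    (h4dist : ∀ a b c d : W, (a, b, c, d) ∈ O4 D →
      a ≠ b ∧ a ≠ c ∧ a ≠ d ∧ b ≠ c ∧ b ≠ d ∧ c ≠ d)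
    {a b c : W} (h : (a, b, c) ∈ O3 W) : ApproxReducesTo (O4 D) 1 (a, b, c) (b, a, c) := by
  have ht : Tendsto (fun d : W => (b, d, c)) (𝓝 a) (𝓝 (b, a, c)) :=
    Continuous.tendsto (by fun_prop) a
  refine ht.frequently ((frequently_mem_O4 h3 h).mono fun d hd => ?_)
  obtain ⟨-, -, -, hbc, hbd, hcd⟩ := h4dist a b c d hd
  exact ⟨⟨hbd, hbc, hcd.symm⟩, .of_stepA hd⟩

theorem approxReducesTo_swap13
    (h3 : ∀ a b c : W, (a, b, c) ∈ O3 W → a ∈ closure (D a b c))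
    (h4dist : ∀ a b c d : W, (a, b, c, d) ∈ O4 D →
      a ≠ b ∧ a ≠ c ∧ a ≠ d ∧ b ≠ c ∧ b ≠ d ∧ c ≠ d)
    {a b c : W} (h : (a, b, c) ∈ O3 W) : ApproxReducesTo (O4 D) 1 (a, b, c) (c, b, a) := by
  have ht : Tendsto (fun d : W => (c, b, d)) (𝓝 a) (𝓝 (c, b, a)) :=
    Continuous.tendsto (by fun_prop) a
  refine ht.frequently ((frequently_mem_O4 h3 h).mono fun d hd => ?_)
  obtain ⟨-, -, -, hbc, hbd, hcd⟩ := h4dist a b c d hd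
  exact ⟨⟨hbc.symm, hcd, hbd⟩, .of_stepB hd⟩

theorem ApproxReducesTo.rotate
    (h3 : ∀ a b c : W, (a, b, c) ∈ O3 W → a ∈ closure (D a b c))
    (h4dist : ∀ a b c d : W, (a, b, c, d) ∈ O4 D →
      a ≠ b ∧ a ≠ c ∧ a ≠ d ∧ b ≠ c ∧ b ≠ d ∧ c ≠ d)
    {n : ℕ} {t : W × W × W} {a b c : W} (h : ApproxReducesTo (O4 D) n t (a, b, c)) :
    ApproxReducesTo (O4 D) (n + 1 + 1) t (c, a, b) := by
  refine (h.trans (fun u => (u.2.1, u.1, u.2.2)) (by fun_prop) rfl (.of_forall fun u hu => ?_)).trans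
    (fun u => (u.2.2, u.2.1, u.1)) (by fun_prop) rfl (.of_forall fun u hu => ?_)
  · exact approxReducesTo_swap12 h3 h4dist hu
  · exact approxReducesTo_swap13 h3 h4dist hu

theorem eventually_dist_lt {ε : ℝ} {a b c x y z : W} (hx : dist x a < ε) (hy : dist y b < ε)
    (hz : dist z c < ε) :
    ∀ᶠ u : W × W × W in 𝓝 (x, y, z),
      dist u.1 a < ε ∧ dist u.2.1 b < ε ∧ dist u.2.2 c < ε := by
  filter_upwards [prod_mem_nhds (Metric.isOpen_ball.mem_nhds hx)
    (prod_mem_nhds (Metric.isOpen_ball.mem_nhds hy) (Metric.isOpen_ball.mem_nhds hz))] with u hu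
  exact hu

/-- Near a given triple, the first point can be replaced by any nearby point, up to an arbitrarily
small perturbation of the result. -/
theorem exists_approxReducesTo_replace
    (h3 : ∀ a b c : W, (a, b, c) ∈ O3 W → a ∈ closure (D a b c))
    (h4open : IsOpen (O4 D))
    (h4dist : ∀ a b c d : W, (a, b, c, d) ∈ O4 D →
      a ≠ b ∧ a ≠ c ∧ a ≠ d ∧ b ≠ c ∧ b ≠ d ∧ c ≠ d)
    (h4rev : ∀ a b c d : W, (a, b, c, d) ∈ O4 D → (d, c, b, a) ∈ O4 D)
    {a b c : W} (h : (a, b, c) ∈ O3 W) :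
    ∃ ε > 0, ∀ x y z w : W, dist x a < ε → dist y b < ε → dist z c < ε → dist w a < ε →
      ApproxReducesTo (O4 D) 4 (x, y, z) (y, z, w) := by
  obtain ⟨d, hd⟩ := (frequently_mem_O4 h3 h).exists
  obtain ⟨ε, hε, hball⟩ := Metric.isOpen_iff.1 h4open _ hd
  have key : ∀ x y z v : W, dist x a < ε → dist y b < ε → dist z c < ε → dist v d < ε →
      (x, y, z, v) ∈ O4 D := fun x y z v hx hy hz hv =>
    hball (by simp [Prod.dist_eq, hx, hy, hz, hv])
  refine ⟨ε, hε, fun x y z w hx hy hz hw => ?_⟩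
  have hq := key x y z d hx hy hz (by simpa using hε)
  obtain ⟨-, -, -, hyz, hyd, hzd⟩ := h4dist _ _ _ _ hq
  have hstart : ApproxReducesTo (O4 D) 1 (x, y, z) (z, y, d) :=
    (ReducesTo.of_stepB hq).approx ⟨hyz.symm, hzd, hyd⟩
  refine (hstart.rotate h3 h4dist).trans (m := 1) (fun u => (u.2.2, u.2.1, w)) (by fun_prop) rfl ?_
  filter_upwards [eventually_dist_lt (ε := ε) (a := d) (b := c) (c := b) (by simpa using hε) hz hy]
    with u hu _
  have hr := h4rev _ _ _ _ (key w u.2.2 u.2.1 u.1 hw hu.2.2 hu.2.1 hu.1)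
  obtain ⟨-, -, -, h23, h2w, h3w⟩ := h4dist _ _ _ _ hr
  exact (ReducesTo.of_stepB hr).approx ⟨h23.symm, h3w, h2w⟩

theorem exists_approxReducesTo_of_dist_lt
    (h3 : ∀ a b c : W, (a, b, c) ∈ O3 W → a ∈ closure (D a b c))
    (h4open : IsOpen (O4 D))
    (h4dist : ∀ a b c d : W, (a, b, c, d) ∈ O4 D →
      a ≠ b ∧ a ≠ c ∧ a ≠ d ∧ b ≠ c ∧ b ≠ d ∧ c ≠ d)
    (h4rev : ∀ a b c d : W, (a, b, c, d) ∈ O4 D → (d, c, b, a) ∈ O4 D)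
    {a b c : W} (h : (a, b, c) ∈ O3 W) :
    ∃ ε > 0, ∀ t s : W × W × W, dist t (a, b, c) < ε → dist s (a, b, c) < ε →
      ApproxReducesTo (O4 D) 12 t s := by
  obtain ⟨hab, hac, hbc⟩ := h
  obtain ⟨ε₁, hε₁, H₁⟩ := exists_approxReducesTo_replace h3 h4open h4dist h4rev
    (a := a) (b := b) (c := c) ⟨hab, hac, hbc⟩
  obtain ⟨ε₂, hε₂, H₂⟩ := exists_approxReducesTo_replace h3 h4open h4dist h4rev
    (a := b) (b := c) (c := a) ⟨hbc, hab.symm, hac.symm⟩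
  obtain ⟨ε₃, hε₃, H₃⟩ := exists_approxReducesTo_replace h3 h4open h4dist h4rev
    (a := c) (b := a) (c := b) ⟨hac.symm, hbc.symm, hab⟩
  refine ⟨min ε₁ (min ε₂ ε₃), by positivity, ?_⟩
  rintro ⟨x, y, z⟩ ⟨x', y', z'⟩ ht hs
  simp only [Prod.dist_eq, max_lt_iff, lt_min_iff] at ht hs
  obtain ⟨⟨hx₁, hy₁, hz₁⟩, ⟨hx₂, hy₂, hz₂⟩, ⟨hx₃, hy₃, hz₃⟩⟩ := ht
  obtain ⟨⟨hx₁', hy₁', hz₁'⟩, ⟨hx₂', hy₂', hz₂'⟩, ⟨hx₃', hy₃', hz₃'⟩⟩ := hs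
  have h₁ := H₁ x y z x' hx₁ hy₁ hz₁ hx₁'
  have h₂ : ApproxReducesTo (O4 D) (4 + 4) (x, y, z) (z, x', y') := by
    refine h₁.trans (m := 4) (fun u => (u.2.1, u.2.2, y')) (by fun_prop) rfl ?_
    filter_upwards [eventually_dist_lt hy₂ hz₂ hx₂'] with u hu _
    exact H₂ u.1 u.2.1 u.2.2 y' hu.1 hu.2.1 hu.2.2 hy₂'
  refine h₂.trans (m := 4) (fun u => (u.2.1, u.2.2, z')) (by fun_prop) rfl ?_
  filter_upwards [eventually_dist_lt hz₃ hx₃' hy₃'] with u hu _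
  exact H₃ u.1 u.2.1 u.2.2 z' hu.1 hu.2.1 hu.2.2 hz₃'

/-- If `t` reduces to triples close to `(y, x, z)`, then it reduces to the initial triple of a
quadruple of `O4 D` whose final triple is exactly `(x, y, z)`. -/
theorem ApproxReducesTo.exists_reducesTo
    (h3 : ∀ a b c : W, (a, b, c) ∈ O3 W → a ∈ closure (D a b c))
    (h4open : IsOpen (O4 D))
    (h4dist : ∀ a b c d : W, (a, b, c, d) ∈ O4 D →
      a ≠ b ∧ a ≠ c ∧ a ≠ d ∧ b ≠ c ∧ b ≠ d ∧ c ≠ d)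
    (h4rev : ∀ a b c d : W, (a, b, c, d) ∈ O4 D → (d, c, b, a) ∈ O4 D)
    {n : ℕ} {t : W × W × W} {x y z : W} (hxyz : (x, y, z) ∈ O3 W)
    (h : ApproxReducesTo (O4 D) n t (y, x, z)) :
    ∃ p, ReducesTo (O4 D) (n + 14) t (p, y, x) ∧ (p, y, x, z) ∈ O4 D := by
  obtain ⟨hxy, hxz, hyz⟩ := hxyz
  obtain ⟨ε, hε, H⟩ := exists_approxReducesTo_of_dist_lt h3 h4open h4dist h4rev
    (a := y) (b := x) (c := z) ⟨hxy.symm, hyz, hxz⟩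
  obtain ⟨p, hp, hpz⟩ := ((frequently_mem_O4 h3 (a := z) (b := x) (c := y)
    ⟨hxz.symm, hyz.symm, hxy⟩).and_eventually (Metric.ball_mem_nhds z hε)).exists
  obtain ⟨-, -, -, -, hxp, hyp⟩ := h4dist _ _ _ _ hp
  obtain ⟨r, hr, hrx⟩ := ((frequently_mem_O4 h3 (a := x) (b := p) (c := y)
    ⟨hxp, hxy, hyp.symm⟩).and_eventually (Metric.ball_mem_nhds x hε)).exists
  obtain ⟨-, -, -, -, hpr, hyr⟩ := h4dist _ _ _ _ hr
  obtain ⟨s, hs, hsy⟩ := ((frequently_mem_O4 h3 (a := y) (b := p) (c := r)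
    ⟨hyp, hyr, hpr⟩).and_eventually (Metric.ball_mem_nhds y hε)).exists
  have hcont : ∀ᶠ v : W × W × W in 𝓝 (s, r, p), (z, x, y, v.2.2) ∈ O4 D ∧
      (x, v.2.2, y, v.2.1) ∈ O4 D ∧ (y, v.2.2, v.2.1, v.1) ∈ O4 D := by
    refine IsOpen.mem_nhds (s := {v : W × W × W | (z, x, y, v.2.2) ∈ O4 D ∧
      (x, v.2.2, y, v.2.1) ∈ O4 D ∧ (y, v.2.2, v.2.1, v.1) ∈ O4 D}) ?_ ⟨hp, hr, hs⟩
    exact (h4open.preimage (by fun_prop)).inter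
      ((h4open.preimage (by fun_prop)).inter (h4open.preimage (by fun_prop)))
  have happrox : ApproxReducesTo (O4 D) (n + 12) t (s, r, p) := by
    refine h.trans (fun _ => (s, r, p)) (by fun_prop) rfl ?_
    filter_upwards [Metric.ball_mem_nhds (y, x, z) hε] with u hu _
    refine H u _ hu ?_
    simp only [Prod.dist_eq, max_lt_iff]
    exact ⟨hsy, hrx, hpz⟩
  obtain ⟨⟨s', r', p'⟩, ⟨-, ht⟩, hp', hr', hs'⟩ := (happrox.and_eventually hcont).exists
  exact ⟨p', (ht.trans (.of_stepA (h4rev _ _ _ _ hs'))).trans (.of_stepB (h4rev _ _ _ _ hr')),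
    h4rev _ _ _ _ hp'⟩

end

/-- Step 5: for every `(a,b,c) ∈ O₃`, the set of `d` with `(b,c,d) ∈ O₃` and
`(a,b,c) ⇝³⁰⁰ (b,c,d)` contains a dense open subset of `W`. -/
theorem leads_step5 {W : Type*} [MetricSpace W] (D : W → W → W → Set W)
    (h2 : ∀ a b c : W, (a, b, c) ∈ O3 W → Dense (D a b c ∪ D a c b))
    (h3 : ∀ a b c : W, (a, b, c) ∈ O3 W → a ∈ closure (D a b c))
    (h4open : IsOpen (O4 D))
    (h4dist : ∀ a b c d : W, (a, b, c, d) ∈ O4 D →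
      a ≠ b ∧ a ≠ c ∧ a ≠ d ∧ b ≠ c ∧ b ≠ d ∧ c ≠ d)
    (h4rev : ∀ a b c d : W, (a, b, c, d) ∈ O4 D → (d, c, b, a) ∈ O4 D)
    (a b c : W) (habc : (a, b, c) ∈ O3 W) :
    ∃ U : Set W, IsOpen U ∧ Dense U ∧
      U ⊆ {d : W | (b, c, d) ∈ O3 W ∧ Leads (O4 D) 300 (a, b, c) (b, c, d)} := by
  have ⟨hab, hac, hbc⟩ := habc
  have hD : ∀ x y z : W, (x, y, z) ∈ O3 W → IsOpen (D x y z) := fun x y z h => by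
    have : D x y z = (fun d => (x, y, z, d)) ⁻¹' O4 D :=
      Set.ext fun d => ⟨fun hd => ⟨h, hd⟩, And.right⟩
    exact this ▸ h4open.preimage (by fun_prop)
  have hacb : (a, c, b) ∈ O3 W := ⟨hac, hab, hbc.symm⟩
  refine ⟨D a b c ∪ D a c b, (hD _ _ _ habc).union (hD _ _ _ hacb), h2 a b c habc, ?_⟩
  rintro d (hd | hd)
  · have hq : (a, b, c, d) ∈ O4 D := ⟨habc, hd⟩
    obtain ⟨-, -, -, -, hbd, hcd⟩ := h4dist _ _ _ _ hq
    have hcbd : (c, b, d) ∈ O3 W := ⟨hbc.symm, hcd, hbd⟩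
    have hrefl : ApproxReducesTo (O4 D) 0 (c, b, d) (c, b, d) :=
      ReducesTo.approx (fun _ _ h => h) hcbd
    obtain ⟨p, hp, hpd⟩ :=
      hrefl.exists_reducesTo h3 h4open h4dist h4rev (x := b) (y := c) ⟨hbc, hbd, hcd⟩
    exact ⟨⟨hbc, hbd, hcd⟩,
      (ReducesTo.of_stepB hq _ _ (hp _ _ (Leads.of_mem hpd))).mono (by norm_num)⟩
  · have hq : (a, c, b, d) ∈ O4 D := ⟨hacb, hd⟩
    obtain ⟨-, -, -, -, hcd, hbd⟩ := h4dist _ _ _ _ hq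
    have hrefl : ApproxReducesTo (O4 D) 0 (a, b, c) (a, b, c) :=
      ReducesTo.approx (fun _ _ h => h) habc
    obtain ⟨p, hp, hpb⟩ :=
      (hrefl.rotate h3 h4dist).exists_reducesTo h3 h4open h4dist h4rev hacb
    exact ⟨⟨hbc, hbd, hcd⟩, (hp.trans (.of_stepB hpb) _ _ (Leads.of_mem hq)).mono (by norm_num)⟩
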